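/- All eigenvalues of a strictly totally positive square matrix are real, positive, and distinct. -/

import Mathlib

open Filter Topology

/-- `x` has `p` entries, in increasing positions, of strictly alternating signs `+ - + ...`. -/
def StrictlyAlternates {m : ℕ} (p : ℕ) (x : Fin m → ℝ) : Prop :=
  ∃ r : Fin p → Fin m, StrictMono r ∧ ∀ i : Fin p, 0 < (-1 : ℝ) ^ (i : ℕ) * x (r i)

/-- `x` has `p` entries, in increasing positions, of weakly alternating signs `+ - + ...`. -/
def WeaklyAlternates {m : ℕ} (p : ℕ) (x : Fin m → ℝ) : Prop :=
  ∃ r : Fin p → Fin m, StrictMono r ∧ ∀ i : Fin p, 0 ≤ (-1 : ℝ) ^ (i : ℕ) * x (r i)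

theorem StrictlyAlternates.weaklyAlternates {m p : ℕ} {x : Fin m → ℝ}
    (h : StrictlyAlternates p x) : WeaklyAlternates p x :=
  let ⟨r, hr, hx⟩ := h
  ⟨r, hr, fun i => (hx i).le⟩

theorem strictlyAlternates_zero {m : ℕ} (x : Fin m → ℝ) : StrictlyAlternates 0 x :=
  ⟨Fin.elim0, fun i => i.elim0, fun i => i.elim0⟩

theorem StrictlyAlternates.le {m p : ℕ} {x : Fin m → ℝ} (h : StrictlyAlternates p x) :
    p ≤ m := by
  obtain ⟨r, hr, -⟩ := h
  simpa using Fintype.card_le_of_injective r hr.injective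

theorem StrictlyAlternates.smul {m p : ℕ} {x : Fin m → ℝ} {a : ℝ} (ha : 0 < a)
    (h : StrictlyAlternates p x) : StrictlyAlternates p (a • x) := by
  obtain ⟨r, hr, hx⟩ := h
  refine ⟨r, hr, fun i => ?_⟩
  have := mul_pos ha (hx i)
  simp only [Pi.smul_apply, smul_eq_mul]
  linarith

theorem WeaklyAlternates.smul {m p : ℕ} {x : Fin m → ℝ} {a : ℝ} (ha : 0 ≤ a)
    (h : WeaklyAlternates p x) : WeaklyAlternates p (a • x) := by
  obtain ⟨r, hr, hx⟩ := h
  refine ⟨r, hr, fun i => ?_⟩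
  have := mul_nonneg ha (hx i)
  simp only [Pi.smul_apply, smul_eq_mul]
  linarith

theorem WeaklyAlternates.dropLast {m p : ℕ} {x : Fin m → ℝ} (h : WeaklyAlternates (p + 1) x) :
    WeaklyAlternates p x := by
  obtain ⟨r, hr, hx⟩ := h
  exact ⟨fun i => r i.castSucc, hr.comp Fin.strictMono_castSucc, fun i => hx i.castSucc⟩

theorem WeaklyAlternates.tail {m p : ℕ} {x : Fin m → ℝ} (h : WeaklyAlternates (p + 1) x) :
    WeaklyAlternates p (-x) := by
  obtain ⟨r, hr, hx⟩ := h
  refine ⟨fun i => r i.succ, hr.comp (Fin.strictMono_succ), fun i => ?_⟩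
  have := hx i.succ
  simpa [pow_succ] using this

theorem isOpen_strictlyAlternates (m p : ℕ) :
    IsOpen {x : Fin m → ℝ | StrictlyAlternates p x} := by
  simp only [StrictlyAlternates, Set.ofPred_exists, Set.ofPred_and, Set.ofPred_forall]
  refine isOpen_iUnion fun r => isOpen_const.inter (isOpen_iInter_of_finite fun i => ?_)
  exact isOpen_lt (by fun_prop) (by fun_prop)

theorem isClosed_weaklyAlternates (m p : ℕ) :
    IsClosed {x : Fin m → ℝ | WeaklyAlternates p x} := by
  simp only [WeaklyAlternates, Set.ofPred_exists, Set.ofPred_and, Set.ofPred_forall]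
  refine isClosed_iUnion_of_finite fun r => isClosed_const.inter (isClosed_iInter fun i => ?_)
  exact isClosed_le (by fun_prop) (by fun_prop)

/-- A vector whose sign pattern `+ - + ...` has fewer than `p + 1` terms splits into `p + 1`
consecutive blocks of weakly constant signs `- + - ...`. -/
theorem exists_monotone_of_not_strictlyAlternates {m p : ℕ} {x : Fin m → ℝ}
    (h : ¬ StrictlyAlternates (p + 1) x) :
    ∃ b : Fin m → Fin (p + 1), Monotone b ∧ ∀ j, (-1 : ℝ) ^ (b j : ℕ) * x j ≤ 0 := by
  classical
  let Q : Fin m → ℕ → Prop := fun j k => ∃ r : Fin k → Fin m, StrictMono r ∧ (∀ i, r i ≤ j) ∧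
    ∀ i : Fin k, 0 < (-1 : ℝ) ^ (i : ℕ) * x (r i)
  have hQ0 : ∀ j, Q j 0 := fun j =>
    ⟨Fin.elim0, fun i => i.elim0, fun i => i.elim0, fun i => i.elim0⟩
  have hQ : ∀ j, Q j (Nat.findGreatest (Q j) p) := fun j =>
    Nat.findGreatest_spec (Nat.zero_le p) (hQ0 j)
  have hle : ∀ j, Nat.findGreatest (Q j) p ≤ p := fun j => Nat.findGreatest_le p
  refine ⟨fun j => ⟨Nat.findGreatest (Q j) p, Nat.lt_succ_of_le (hle j)⟩, ?_, ?_⟩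
  · intro j j' hjj'
    obtain ⟨r, hr, hrj, hx⟩ := hQ j
    exact Fin.mk_le_mk.2 (Nat.le_findGreatest (hle j) ⟨r, hr, fun i => (hrj i).trans hjj', hx⟩)
  · intro j
    by_contra! hpos
    dsimp only at hpos
    obtain ⟨r, hr, hrj, hx⟩ := hQ j
    have hmax : ∀ n, n ≤ p → Q j n → n ≤ Nat.findGreatest (Q j) p := fun n hn hq =>
      Nat.le_findGreatest hn hq
    have hlep := hle j
    generalize Nat.findGreatest (Q j) p = k at *
    have hlt : ∀ i, r i < j := by
      intro i
      refine lt_of_le_of_ne (hrj i) fun hij => ?_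
      have hi : (i : ℕ) + 1 = k := by
        by_contra hne
        have hi' : (i : ℕ) + 1 < k := by omega
        have h1 := hr (show i < ⟨i + 1, hi'⟩ from Fin.mk_lt_mk.2 (Nat.lt_succ_self _))
        exact absurd (hrj ⟨i + 1, hi'⟩) (by rw [← hij]; exact not_le.2 h1)
      have := hx i
      rw [hij] at this
      rw [← hi, pow_succ] at hpos
      linarith
    have hs : StrictMono (Fin.snoc r j : Fin (k + 1) → Fin m) := by
      intro a c hac
      induction c using Fin.lastCases with
      | last =>
        induction a using Fin.lastCases with
        | last => exact absurd hac (lt_irrefl _)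
        | cast a => simpa using hlt a
      | cast c =>
        induction a using Fin.lastCases with
        | last => exact absurd hac (not_lt.2 (Fin.le_last _))
        | cast a => simpa using hr (Fin.castSucc_lt_castSucc_iff.1 hac)
    have hsx : ∀ i : Fin (k + 1),
        0 < (-1 : ℝ) ^ (i : ℕ) * x ((Fin.snoc r j : Fin (k + 1) → Fin m) i) := by
      intro i
      induction i using Fin.lastCases with
      | last => simpa using hpos
      | cast i => simpa using hx i
    rcases hlep.lt_or_eq with hk | rfl
    · have := hmax (k + 1) hk ⟨_, hs, fun i => ?_, hsx⟩
      · omega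
      · induction i using Fin.lastCases with
        | last => simp
        | cast i => simpa using hrj i
    · exact h ⟨_, hs, hsx⟩

/-- The Cauchy–Binet expansion, over all maps instead of the increasing ones only. -/
theorem det_mul_eq_sum {m n : ℕ} (C : Matrix (Fin n) (Fin m) ℝ) (M : Matrix (Fin m) (Fin n) ℝ) :
    (C * M).det = ∑ f : Fin n → Fin m, (∏ k, M (f k) k) * (C.submatrix id f).det := by
  rw [← Matrix.det_transpose]
  have : (C * M).transpose = fun k => ∑ j, M j k • (C.transpose j) := by
    ext k i
    simp [Matrix.mul_apply, mul_comm]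
  rw [this]
  have := (Matrix.detRowAlternating (n := Fin n) (R := ℝ)).toMultilinearMap.map_sum
    (fun k j => M j k • (C.transpose j))
  refine Eq.trans this (Finset.sum_congr rfl fun f _ => ?_)
  have h2 := (Matrix.detRowAlternating (n := Fin n) (R := ℝ)).toMultilinearMap.map_smul_univ
    (fun k => M (f k) k) (fun k => C.transpose (f k))
  refine h2.trans ?_
  rw [smul_eq_mul, ← Matrix.det_transpose (C.submatrix id f)]
  rfl

/-- A square matrix is strictly totally positive if all its minors are positive. -/
def Matrix.IsStrictlyTotallyPositive {m : ℕ} (A : Matrix (Fin m) (Fin m) ℝ) : Prop :=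
  ∀ ⦃k : ℕ⦄ ⦃r c : Fin k → Fin m⦄, StrictMono r → StrictMono c → 0 < (A.submatrix r c).det

section VariationDiminishing

variable {m : ℕ} {A : Matrix (Fin m) (Fin m) ℝ}

theorem det_merge_term_nonneg (hA : A.IsStrictlyTotallyPositive)
    {n q : ℕ} {r : Fin n → Fin m} (hr : StrictMono r) {b : Fin m → Fin q} (hb : Monotone b)
    {s : Fin n → Fin q} (hs : StrictMono s) {c : Fin m → ℝ} (hc : ∀ j, 0 ≤ c j)
    (f : Fin n → Fin m) :
    0 ≤ (∏ k, (if b (f k) = s k then c (f k) else 0)) * (A.submatrix r f).det := by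
  by_cases hf : ∀ k, b (f k) = s k
  · have hfm : StrictMono f := fun i j hij => hb.reflect_lt (by rw [hf, hf]; exact hs hij)
    refine mul_nonneg (Finset.prod_nonneg fun k _ => ?_) (hA hr hfm).le
    split_ifs
    exacts [hc _, le_rfl]
  · push Not at hf
    obtain ⟨k, hk⟩ := hf
    rw [Finset.prod_eq_zero (Finset.mem_univ k) (if_neg hk), zero_mul]

theorem det_merge_nonneg (hA : A.IsStrictlyTotallyPositive)
    {n q : ℕ} {r : Fin n → Fin m} (hr : StrictMono r) {b : Fin m → Fin q} (hb : Monotone b)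
    {s : Fin n → Fin q} (hs : StrictMono s) {c : Fin m → ℝ} (hc : ∀ j, 0 ≤ c j) :
    0 ≤ (A.submatrix r id * Matrix.of fun j k => if b j = s k then c j else 0).det := by
  rw [det_mul_eq_sum]
  exact Finset.sum_nonneg fun f _ => det_merge_term_nonneg hA hr hb hs hc f

theorem det_merge_pos (hA : A.IsStrictlyTotallyPositive)
    {n q : ℕ} {r : Fin n → Fin m} (hr : StrictMono r) {b : Fin m → Fin q} (hb : Monotone b)
    {s : Fin n → Fin q} (hs : StrictMono s) {c : Fin m → ℝ} (hc : ∀ j, 0 ≤ c j)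
    (hpos : ∀ k, ∃ j, b j = s k ∧ 0 < c j) :
    0 < (A.submatrix r id * Matrix.of fun j k => if b j = s k then c j else 0).det := by
  rw [det_mul_eq_sum]
  choose f hf hcf using hpos
  refine Finset.sum_pos' (fun f _ => det_merge_term_nonneg hA hr hb hs hc f)
    ⟨f, Finset.mem_univ f, mul_pos (Finset.prod_pos fun k _ => ?_) (hA hr ?_)⟩
  · simpa [hf] using hcf k
  · exact fun i j hij => hb.reflect_lt (by simpa only [id, hf] using hs hij)

/-- If a vector is split in `p + 1` blocks of signs `- + - ...`, `p ≥ 1`, and has both alternating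
patterns of length `p`, or if it is nonzero and `p = 0`, then each block has a nonzero entry. -/
theorem exists_mem_block {p : ℕ} {x : Fin m → ℝ} (hx : x ≠ 0) {b : Fin m → Fin (p + 1)}
    (hb : Monotone b) (hbx : ∀ j, (-1 : ℝ) ^ (b j : ℕ) * x j ≤ 0)
    (hp : StrictlyAlternates p x) (hn : StrictlyAlternates p (-x)) (k : Fin (p + 1)) :
    ∃ j, b j = k ∧ x j ≠ 0 := by
  have key : ∀ (e : ℕ) (r : Fin p → Fin m), StrictMono r → e ≤ 1 →
      (∀ i : Fin p, (-1 : ℝ) ^ ((i : ℕ) + e) * x (r i) < 0) → ∀ i, (b (r i) : ℕ) = i + e := by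
    intro e r hr he hs
    have hpar : ∀ i, Even ((b (r i) : ℕ) + (i + e)) := by
      intro i
      by_contra hodd
      rw [Nat.not_even_iff_odd] at hodd
      have h1 : (-1 : ℝ) ^ ((b (r i) : ℕ) + (i + e)) = -1 := hodd.neg_one_pow
      rw [pow_add] at h1
      have h2 := hbx (r i)
      have h3 := hs i
      rcases neg_one_pow_eq_or ℝ (b (r i) : ℕ) with h | h <;>
        rcases neg_one_pow_eq_or ℝ ((i : ℕ) + e) with h' | h' <;>
        rw [h] at h1 h2 <;> rw [h'] at h1 h3 <;> linarith
    have hstep : ∀ i j : Fin p, (j : ℕ) = i + 1 → (b (r i) : ℕ) + 1 ≤ b (r j) := by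
      intro i j hij
      have h1 : (b (r i) : ℕ) ≤ b (r j) := hb (hr (by rw [Fin.lt_def]; omega)).le
      have h2 := hpar i
      have h3 := hpar j
      rw [Nat.even_iff] at h2 h3
      omega
    have hlow : ∀ n (hn : n < p), n + e ≤ (b (r ⟨n, hn⟩) : ℕ) := by
      intro n
      induction n with
      | zero =>
        intro hn
        have := hpar ⟨0, hn⟩
        rw [Nat.even_iff] at this
        dsimp only at this
        omega
      | succ n ih =>
        intro hn
        have := hstep ⟨n, by omega⟩ ⟨n + 1, hn⟩ rfl
        have := ih (by omega)
        omega
    have hupp : ∀ n (hn : n < p), (b (r ⟨p - 1 - n, by omega⟩) : ℕ) ≤ p - n := by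
      intro n
      induction n with
      | zero =>
        intro hn
        have := (b (r ⟨p - 1 - 0, by omega⟩)).isLt
        omega
      | succ n ih =>
        intro hn
        have := hstep ⟨p - 1 - (n + 1), by omega⟩ ⟨p - 1 - n, by omega⟩ (by dsimp only; omega)
        have := ih (by omega)
        omega
    intro i
    have h1 := hlow i i.isLt
    have h2 := hupp (p - 1 - i) (by omega)
    have h3 : (⟨p - 1 - (p - 1 - i), by omega⟩ : Fin p) = i := by
      ext; dsimp only; omega
    rw [h3] at h2
    have h4 := hpar i
    rw [Nat.even_iff] at h4
    simp only [Fin.eta] at h1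
    omega
  obtain ⟨r, hr, hrx⟩ := hp
  obtain ⟨t, ht, htx⟩ := hn
  by_cases hk : (k : ℕ) < p
  · refine ⟨t ⟨k, hk⟩, Fin.ext ?_, fun h0 => ?_⟩
    · exact key 0 t ht (by omega) (fun i => by simpa using htx i) ⟨k, hk⟩
    · simpa [h0] using htx ⟨k, hk⟩
  · have hkp : (k : ℕ) = p := by omega
    rcases Nat.eq_zero_or_pos p with rfl | hp0
    · obtain ⟨j, hj⟩ := Function.ne_iff.1 hx
      exact ⟨j, Subsingleton.elim (α := Fin 1) _ _, hj⟩
    · have := key 1 r hr le_rfl (fun i => by simpa [pow_succ] using hrx i) ⟨p - 1, by omega⟩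
      refine ⟨r ⟨p - 1, by omega⟩, Fin.ext (by rw [this]; dsimp only; omega), fun h0 => ?_⟩
      simpa [h0] using hrx ⟨p - 1, by omega⟩

/-- The variation diminishing property of strictly totally positive matrices. -/
theorem StrictlyAlternates.of_mulVec (hA : A.IsStrictlyTotallyPositive)
    {p : ℕ} {x : Fin m → ℝ} (hx : x ≠ 0)
    (h : WeaklyAlternates p (A.mulVec x)) : StrictlyAlternates p x := by
  induction p generalizing x with
  | zero => exact strictlyAlternates_zero x
  | succ p ih =>
    by_contra hcon
    obtain ⟨b, hb, hbx⟩ := exists_monotone_of_not_strictlyAlternates hcon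
    have hblock := exists_mem_block hx hb hbx (ih hx h.dropLast)
      (ih (neg_ne_zero.2 hx) (by rw [Matrix.mulVec_neg]; exact h.tail))
    obtain ⟨r, hr, hrx⟩ := h
    set c : Fin m → ℝ := fun j => -((-1 : ℝ) ^ (b j : ℕ) * x j) with hc
    have hc0 : ∀ j, 0 ≤ c j := fun j => neg_nonneg.2 (hbx j)
    have hdet := det_merge_pos hA hr hb strictMono_id hc0 (fun k => by
      obtain ⟨j, hj, hxj⟩ := hblock k
      exact ⟨j, hj, lt_of_le_of_ne (hc0 j) (by simpa [hc] using hxj)⟩)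
    set M : Matrix (Fin m) (Fin (p + 1)) ℝ :=
      Matrix.of fun j k => if b j = id k then c j else 0 with hM
    set B := A.submatrix r id * M with hB
    let d : Fin (p + 1) → ℝ := fun k => (-1) ^ (k : ℕ)
    have hMd : M.mulVec d = -x := by
      ext j
      have hsq : (-1 : ℝ) ^ (b j : ℕ) * (-1 : ℝ) ^ (b j : ℕ) = 1 := by
        rw [← mul_pow]; simp
      simp only [Matrix.mulVec, dotProduct, hM, Matrix.of_apply, id, ite_mul, zero_mul,
        Finset.sum_ite_eq, Finset.mem_univ, if_true, hc, d, Pi.neg_apply]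
      linear_combination -(x j) * hsq
    have hBd : B.mulVec d = fun i => -(A.mulVec x (r i)) := by
      rw [hB, ← Matrix.mulVec_mulVec, hMd, Matrix.mulVec_neg]
      rfl
    have hcram : B.det = ∑ i, B.adjugate 0 i * -(A.mulVec x (r i)) := by
      have h1 : (B.adjugate.mulVec (B.mulVec d)) 0 = B.det := by
        rw [Matrix.mulVec_mulVec, Matrix.adjugate_mul, Matrix.smul_mulVec, Matrix.one_mulVec]
        simp [d]
      rw [← h1, hBd]
      rfl
    have hle : B.det ≤ 0 := by
      rw [hcram]
      refine Finset.sum_nonpos fun i _ => ?_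
      rw [Matrix.adjugate_fin_succ_eq_det_submatrix]
      have hminor := det_merge_nonneg hA (hr.comp (Fin.strictMono_succAbove i)) hb
        (Fin.strictMono_succAbove 0) hc0
      have heq : B.submatrix i.succAbove (Fin.succAbove 0) =
          A.submatrix (r ∘ i.succAbove) id *
            Matrix.of fun j k => if b j = Fin.succAbove 0 k then c j else 0 := by
        ext a e
        simp only [hB, hM, Matrix.mul_apply, Matrix.submatrix_apply, Matrix.of_apply, id,
          Function.comp_apply]
      rw [heq]
      have := mul_nonneg hminor (hrx i)
      simp only [Fin.val_zero, add_zero]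
      linarith
    exact absurd hdet (not_lt.2 hle)

end VariationDiminishing

theorem StrictlyAlternates.weaklyAlternates_neg {m p : ℕ} {x : Fin (m + 1) → ℝ} (hx : x 0 = 0)
    (h : StrictlyAlternates p x) : WeaklyAlternates (p + 1) (-x) := by
  obtain ⟨r, hr, hrx⟩ := h
  have hr0 : ∀ i, 0 < r i := fun i => by
    rw [Fin.pos_iff_ne_zero]
    intro h0
    simpa [h0, hx] using hrx i
  refine ⟨Fin.cons 0 r, ?_, fun i => ?_⟩
  · intro a c hac
    induction c using Fin.cases with
    | zero => exact absurd hac (Fin.not_lt_zero a)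
    | succ c =>
      induction a using Fin.cases with
      | zero => simpa using hr0 c
      | succ a => simpa using hr (Fin.succ_lt_succ_iff.1 hac)
  · induction i using Fin.cases with
    | zero => simp [hx]
    | succ i => simpa [pow_succ] using (hrx i).le

theorem StrictlyAlternates.succ_or_succ_neg {m p : ℕ} {x : Fin m → ℝ} (hp : p ≠ 0)
    (h : StrictlyAlternates p x) (h' : StrictlyAlternates p (-x)) :
    StrictlyAlternates (p + 1) x ∨ StrictlyAlternates (p + 1) (-x) := by
  have key : ∀ {q : ℕ} {y : Fin m → ℝ} (r t : Fin (q + 1) → Fin m), StrictMono t →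
      (∀ i : Fin (q + 1), 0 < (-1 : ℝ) ^ (i : ℕ) * (-y) (t i)) → r 0 < t 0 → 0 < y (r 0) →
      StrictlyAlternates (q + 2) y := by
    intro q y r t ht hty hrt hy
    refine ⟨Fin.cons (r 0) t, ?_, fun i => ?_⟩
    · intro a c hac
      induction c using Fin.cases with
      | zero => exact absurd hac (Fin.not_lt_zero a)
      | succ c =>
        induction a using Fin.cases with
        | zero => simpa using hrt.trans_le (ht.monotone (Fin.zero_le c))
        | succ a => simpa using ht (Fin.succ_lt_succ_iff.1 hac)
    · induction i using Fin.cases with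
      | zero => simpa using hy
      | succ i => simpa [pow_succ] using hty i
  obtain ⟨q, rfl⟩ := Nat.exists_eq_succ_of_ne_zero hp
  obtain ⟨r, hr, hrx⟩ := h
  obtain ⟨t, ht, htx⟩ := h'
  have hr0 : 0 < x (r 0) := by simpa using hrx 0
  have ht0 : 0 < (-x) (t 0) := by simpa using htx 0
  rcases lt_trichotomy (r 0) (t 0) with hlt | heq | hgt
  · exact .inl (key r t ht htx hlt hr0)
  · rw [← heq, Pi.neg_apply] at ht0
    linarith
  · exact .inr (key t r hr (by simpa using hrx) hgt ht0)

theorem not_forall_weaklyAlternates_imp {m : ℕ} {x : Fin (m + 1) → ℝ} (hx0 : x 0 = 0)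
    (h : ∀ p, WeaklyAlternates p x → StrictlyAlternates p x)
    (h' : ∀ p, WeaklyAlternates p (-x) → StrictlyAlternates p (-x)) : False := by
  have key : ∀ p, StrictlyAlternates p x ∧ StrictlyAlternates p (-x) := by
    intro p
    induction p with
    | zero => exact ⟨strictlyAlternates_zero _, strictlyAlternates_zero _⟩
    | succ p ih =>
      refine ⟨h _ ?_, h' _ (ih.1.weaklyAlternates_neg hx0)⟩
      simpa using ih.2.weaklyAlternates_neg (by simpa using hx0)
  exact absurd (key (m + 2)).1.le (by omega)

namespace Matrix.IsStrictlyTotallyPositive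

section

variable {m : ℕ} {A : Matrix (Fin m) (Fin m) ℝ}

theorem det_pos (hA : A.IsStrictlyTotallyPositive) : 0 < A.det := by
  simpa using hA (r := id) (c := id) strictMono_id strictMono_id

theorem mulVec_ne_zero (hA : A.IsStrictlyTotallyPositive) {x : Fin m → ℝ} (hx : x ≠ 0) :
    A.mulVec x ≠ 0 := fun h =>
  hA.det_pos.ne' (Matrix.exists_mulVec_eq_zero_iff.1 ⟨x, hx, h⟩)

theorem strictlyAlternates_of_pow_mulVec (hA : A.IsStrictlyTotallyPositive) {p : ℕ}
    {x : Fin m → ℝ} (hx : x ≠ 0) (n : ℕ) (h : StrictlyAlternates p ((A ^ n).mulVec x)) :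
    StrictlyAlternates p x := by
  induction n generalizing x with
  | zero => simpa using h
  | succ n ih =>
    rw [pow_succ, ← Matrix.mulVec_mulVec] at h
    exact .of_mulVec hA hx (ih (hA.mulVec_ne_zero hx) h).weaklyAlternates

theorem eigenvalue_pos (hA : A.IsStrictlyTotallyPositive) {u : Fin m → ℝ} (hu : u ≠ 0) {l : ℝ}
    (h : A.mulVec u = l • u) : 0 < l := by
  by_contra! hl
  have hl0 : 0 ≤ -l := by linarith
  have hflip : ∀ {y : Fin m → ℝ} {p : ℕ}, y ≠ 0 → A.mulVec y = l • y →
      StrictlyAlternates p (-y) → StrictlyAlternates p y := by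
    intro y p hy hAy hp
    refine .of_mulVec hA hy ?_
    rw [hAy]
    simpa using hp.weaklyAlternates.smul hl0
  have hu' : -u ≠ 0 := neg_ne_zero.2 hu
  have h' : A.mulVec (-u) = l • -u := by rw [Matrix.mulVec_neg, h, smul_neg]
  have hboth : ∀ {p}, StrictlyAlternates p u ∨ StrictlyAlternates p (-u) →
      StrictlyAlternates p u ∧ StrictlyAlternates p (-u) := by
    rintro p (hp | hp)
    · exact ⟨hp, hflip hu' h' (by simpa using hp)⟩
    · exact ⟨hflip hu h hp, hp⟩
  have key : ∀ p, StrictlyAlternates (p + 1) u ∧ StrictlyAlternates (p + 1) (-u) := by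
    intro p
    induction p with
    | zero =>
      obtain ⟨j, hj⟩ := Function.ne_iff.1 hu
      refine hboth ((lt_or_gt_of_ne hj).symm.imp (fun hj => ?_) fun hj => ?_) <;>
        exact ⟨fun _ => j, Subsingleton.strictMono (α := Fin 1) _, by simpa using hj⟩
    | succ p ih => exact hboth (ih.1.succ_or_succ_neg p.succ_ne_zero ih.2)
  exact absurd (key m).1.le (by omega)

end

variable {m : ℕ} {A : Matrix (Fin (m + 1)) (Fin (m + 1)) ℝ}

theorem eq_zero_of_complex_eigenvector (hA : A.IsStrictlyTotallyPositive) {z : Fin (m + 1) → ℂ}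
    {l : ℂ} (h : (A.map Complex.ofReal).mulVec z = l • z) (hl : l ≠ 0) (hz : (z 0).re = 0) :
    (fun i => (z i).re) = 0 := by
  by_contra hx
  let R : (Fin (m + 1) → ℂ) → Fin (m + 1) → ℝ := fun w i => (w i).re
  have hAR : ∀ w, A.mulVec (R w) = R ((A.map Complex.ofReal).mulVec w) := by
    intro w
    ext i
    simp [R, Matrix.mulVec, dotProduct]
  have hRc : Continuous R := by fun_prop
  have hRsmul : ∀ (a : ℝ) (w), R ((a : ℂ) • w) = a • R w := by
    intro a w
    ext i
    simp [R]
  have hpow : ∀ (n : ℕ) (a : ℂ), (A ^ n).mulVec (R (a • z)) = R ((l ^ n * a) • z) := by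
    intro n
    induction n with
    | zero => simp
    | succ n ih =>
      intro a
      rw [pow_succ, ← Matrix.mulVec_mulVec, hAR, Matrix.mulVec_smul, h, smul_smul, ih]
      congr 2
      ring
  have hAz : A.mulVec (R (l⁻¹ • z)) = R z := by
    simpa [hl] using hpow 1 l⁻¹
  have hy : R (l⁻¹ • z) ≠ 0 := by
    intro h0
    rw [h0, Matrix.mulVec_zero] at hAz
    exact hx hAz.symm
  have hnorm : 0 < ‖l‖ := norm_pos_iff.2 hl
  let w : Circle := ⟨l / ‖l‖, by simp [Submonoid.unitSphere, hl]⟩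
  have hw : (w : ℂ) = l / ‖l‖ := rfl
  have hrec : ∀ (a : ℂ) (p : ℕ), StrictlyAlternates p (R (a • z)) →
      ∃ n, StrictlyAlternates p ((A ^ (n + 1)).mulVec (R (a • z))) := by
    intro a p hp
    have hcl := mapClusterPt_one_atTop_pow w
    have hopen : IsOpen {c : Circle | StrictlyAlternates p (R (((c : ℂ) * a) • z))} :=
      (isOpen_strictlyAlternates (m + 1) p).preimage (by fun_prop)
    have hfreq := hcl.frequently (hopen.mem_nhds (show (1 : Circle) ∈ _ by simpa using hp))
    obtain ⟨n, hn, hpn⟩ := (frequently_atTop.1 hfreq) 1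
    obtain ⟨n, rfl⟩ := Nat.exists_eq_add_of_le' hn
    refine ⟨n, ?_⟩
    rw [hpow]
    have := StrictlyAlternates.smul (pow_pos hnorm (n + 1)) hpn
    rw [← hRsmul, smul_smul] at this
    convert this using 3
    have hn0 : (‖l‖ : ℂ) ≠ 0 := by exact_mod_cast hnorm.ne'
    rw [Circle.coe_pow, hw, Complex.ofReal_pow, ← mul_assoc, ← mul_pow, mul_div_cancel₀ _ hn0]
  have main : ∀ a : ℂ, R ((l⁻¹ * a) • z) ≠ 0 → A.mulVec (R ((l⁻¹ * a) • z)) = R (a • z) →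
      ∀ p, WeaklyAlternates p (R (a • z)) → StrictlyAlternates p (R (a • z)) := by
    intro a hne hAa p hp
    obtain ⟨n, hn⟩ := hrec _ p (.of_mulVec hA hne (by rwa [hAa]))
    rw [pow_succ, ← Matrix.mulVec_mulVec, hAa] at hn
    exact hA.strictlyAlternates_of_pow_mulVec (hAa ▸ hA.mulVec_ne_zero hne) n hn
  have hneg : ∀ v, R (-v) = -R v := fun v => by ext i; simp [R]
  refine not_forall_weaklyAlternates_imp (x := R z) hz ?_ ?_
  · simpa using main 1 (by simpa using hy) (by simpa using hAz)
  · simpa [hneg] using main (-1) (by simpa [hneg] using hy)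
      (by simpa [hneg, Matrix.mulVec_neg] using hAz)

theorem eigenvector_zero_ne_zero (hA : A.IsStrictlyTotallyPositive) {u : Fin (m + 1) → ℝ}
    (hu : u ≠ 0) {l : ℝ} (h : A.mulVec u = l • u) : u 0 ≠ 0 := by
  intro h0
  refine hu (hA.eq_zero_of_complex_eigenvector (z := fun i => (u i : ℂ)) (l := l) ?_ ?_ ?_)
  · ext i
    have := congrArg Complex.ofReal (congrFun h i)
    simpa [Matrix.mulVec, dotProduct] using this
  · exact_mod_cast (hA.eigenvalue_pos hu h).ne'
  · simpa using h0

theorem complex_eigenvalue_im_eq_zero (hA : A.IsStrictlyTotallyPositive) {z : Fin (m + 1) → ℂ}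
    (hz : z ≠ 0) {l : ℂ} (h : (A.map Complex.ofReal).mulVec z = l • z) : l.im = 0 := by
  by_contra hl
  have hl0 : l ≠ 0 := fun h0 => hl (by simp [h0])
  obtain ⟨a, ha, haz⟩ : ∃ a : ℂ, a ≠ 0 ∧ (a * z 0).re = 0 := by
    by_cases h0 : z 0 = 0
    · exact ⟨1, one_ne_zero, by simp [h0]⟩
    · refine ⟨Complex.I / z 0, div_ne_zero Complex.I_ne_zero h0, ?_⟩
      rw [div_mul_cancel₀ _ h0, Complex.I_re]
  have hre := hA.eq_zero_of_complex_eigenvector (z := a • z) (l := l)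
    (by rw [Matrix.mulVec_smul, h, smul_comm]) hl0 (by simpa using haz)
  obtain ⟨j, hj⟩ := Function.ne_iff.1 hz
  have hrej : ∀ i, (a * z i).re = 0 := fun i => congrFun hre i
  have him : (a * z j).im ≠ 0 := fun him =>
    mul_ne_zero ha hj (Complex.ext (hrej j) him)
  have hA' : (A.map Complex.ofReal).mulVec (a • z) = l • a • z := by
    rw [Matrix.mulVec_smul, h, smul_comm]
  have hj' := congrArg Complex.re (congrFun hA' j)
  simp only [Matrix.mulVec, dotProduct, Matrix.map_apply, Pi.smul_apply, smul_eq_mul,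
    Complex.re_sum, Complex.re_ofReal_mul, hrej, mul_zero, Finset.sum_const_zero,
    Complex.mul_re l, zero_sub] at hj'
  exact mul_ne_zero hl him (by linarith)

/-- There are no Jordan chains of length two. -/
theorem mulVec_ne_smul_add (hA : A.IsStrictlyTotallyPositive) {u v : Fin (m + 1) → ℝ}
    (hu : u ≠ 0) {l : ℝ} (h : A.mulVec u = l • u) : A.mulVec v ≠ l • v + u := by
  intro hv
  have hl := hA.eigenvalue_pos hu h
  have hu0 := hA.eigenvector_zero_ne_zero hu h
  obtain ⟨v, hv, hv0⟩ : ∃ v, A.mulVec v = l • v + l • u ∧ v 0 = 0 := by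
    refine ⟨l • v - (l * v 0 / u 0) • u, ?_, ?_⟩
    · rw [Matrix.mulVec_sub, Matrix.mulVec_smul, Matrix.mulVec_smul, hv, h]
      module
    · simp [hu0]
  have hne : ∀ s t : ℝ, s ≠ 0 → s • v + t • u ≠ 0 := by
    intro s t hs h0
    have ht : t = 0 := by
      have := congrFun h0 0
      simpa [hv0, hu0] using this
    have hv0 : v = 0 := by simpa [ht, hs] using h0
    rw [hv0, Matrix.mulVec_zero, smul_zero, zero_add] at hv
    exact smul_ne_zero hl.ne' hu hv.symm
  have hstep : ∀ (s t : ℝ) (p : ℕ), s ≠ 0 → WeaklyAlternates p (s • v + (t + s) • u) →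
      StrictlyAlternates p (s • v + t • u) := by
    intro s t p hs hp
    refine .of_mulVec hA (hne s t hs) ?_
    rw [Matrix.mulVec_add, Matrix.mulVec_smul, Matrix.mulVec_smul, hv, h]
    convert hp.smul hl.le using 1
    module
  have hsteps : ∀ (s t : ℝ) (p n : ℕ), s ≠ 0 → StrictlyAlternates p (s • v + (t + n * s) • u) →
      StrictlyAlternates p (s • v + t • u) := by
    intro s t p n hs
    induction n with
    | zero => simp
    | succ n ih =>
      intro hp
      refine ih (hstep _ _ _ hs ?_)
      convert hp.weaklyAlternates using 3
      push_cast
      ring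
  have hlim : ∀ s : ℝ, Tendsto (fun n : ℕ => (n + 1 : ℝ)⁻¹ • (s • v + ((n : ℝ) + 1) • u))
      atTop (𝓝 u) := by
    intro s
    have h1 : Tendsto (fun n : ℕ => (n + 1 : ℝ)⁻¹ • (s • v) + u) atTop
        (𝓝 ((0 : ℝ) • (s • v) + u)) := by
      refine Tendsto.add_const _ (Tendsto.smul_const ?_ _)
      simpa using tendsto_one_div_add_atTop_nhds_zero_nat (𝕜 := ℝ)
    rw [zero_smul, zero_add] at h1
    refine h1.congr fun n => ?_
    have : (n + 1 : ℝ) ≠ 0 := by positivity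
    rw [smul_add, smul_smul _ _ u, inv_mul_cancel₀ this, one_smul]
  have hforward : ∀ p, StrictlyAlternates p u → StrictlyAlternates p v := by
    intro p hp
    obtain ⟨n, hn⟩ := ((hlim 1).eventually
      ((isOpen_strictlyAlternates (m + 1) p).mem_nhds hp)).exists
    have hpos : (0 : ℝ) < n + 1 := by positivity
    have hn' := StrictlyAlternates.smul hpos hn
    rw [smul_smul, mul_inv_cancel₀ hpos.ne', one_smul] at hn'
    simpa using hsteps 1 0 p (n + 1) one_ne_zero (by simpa using hn')
  have hbackward : ∀ p, WeaklyAlternates p (-v) → StrictlyAlternates p u := by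
    intro p hp
    have hback : ∀ n : ℕ, StrictlyAlternates p ((-1 : ℝ) • v + ((n : ℝ) + 1) • u) := by
      intro n
      induction n with
      | zero => exact hstep (-1) _ p (by norm_num) (by simpa using hp)
      | succ n ih =>
        refine hstep (-1) _ p (by norm_num) ?_
        simpa using ih.weaklyAlternates
    have hweak : WeaklyAlternates p u :=
      (isClosed_weaklyAlternates (m + 1) p).mem_of_tendsto (hlim (-1)) (.of_forall fun n =>
        (hback n).weaklyAlternates.smul (by positivity))
    exact .of_mulVec hA hu (by rw [h]; exact hweak.smul hl.le)
  have key : ∀ p, StrictlyAlternates p u := by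
    intro p
    induction p with
    | zero => exact strictlyAlternates_zero u
    | succ p ih => exact hbackward _ ((hforward p ih).weaklyAlternates_neg hv0)
  exact absurd (key (m + 2)).le (by omega)

theorem rootMultiplicity_charpoly_le_one (hA : A.IsStrictlyTotallyPositive) (l : ℝ) :
    A.charpoly.rootMultiplicity l ≤ 1 := by
  let φ : Module.End ℝ (Fin (m + 1) → ℝ) := Matrix.toLin' A
  have hφ : ∀ x, (φ - l • 1) x = A.mulVec x - l • x := fun x => by simp [φ]
  have hker : ∀ (n : ℕ) x, ((φ - l • 1) ^ n) x = 0 → A.mulVec x = l • x := by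
    intro n
    induction n with
    | zero => intro x hx; simp_all
    | succ n ih =>
      intro x hx
      rw [pow_succ, Module.End.mul_apply] at hx
      have h1 := ih _ hx
      by_contra hne
      refine hA.mulVec_ne_smul_add (v := x) (u := A.mulVec x - l • x) (sub_ne_zero.2 hne) ?_
        (by abel)
      rwa [hφ] at h1
  have hroot : A.charpoly.rootMultiplicity l =
      Module.finrank ℝ (φ.maxGenEigenspace l) := by
    rw [LinearMap.finrank_maxGenEigenspace_eq, Matrix.charpoly_toLin']
  rw [hroot]
  let π : φ.maxGenEigenspace l →ₗ[ℝ] ℝ :=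
    (LinearMap.proj (R := ℝ) (φ := fun _ : Fin (m + 1) => ℝ) 0).comp (Submodule.subtype _)
  have hπ : Function.Injective π := by
    rw [injective_iff_map_eq_zero]
    intro x hx
    obtain ⟨n, hn⟩ := (Module.End.mem_maxGenEigenspace φ l x).1 x.2
    by_contra hne
    exact hA.eigenvector_zero_ne_zero (fun h => hne (Subtype.ext h)) (hker n x hn) hx
  simpa using LinearMap.finrank_le_finrank_of_injective hπ

end Matrix.IsStrictlyTotallyPositive

theorem strictly_totally_positive_eigenvalues_real_pos_distinct (m : ℕ)
    (A : Matrix (Fin m) (Fin m) ℝ)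
    (hSTP : ∀ (k : ℕ) (r c : Fin k → Fin m),
      StrictMono r → StrictMono c → 0 < (A.submatrix r c).det) :
    ∃ μ : Fin m → ℝ, StrictMono μ ∧ (∀ i, 0 < μ i) ∧
      (A.map (Complex.ofReal)).charpoly =
        ∏ i : Fin m, (Polynomial.X - Polynomial.C (μ i : ℂ)) := by
  rcases m with _ | m
  · exact ⟨Fin.elim0, fun i => i.elim0, fun i => i.elim0, by simp [Matrix.charpoly]⟩
  have hA : A.IsStrictlyTotallyPositive := fun k r c => hSTP k r c
  have hmap : (A.map Complex.ofReal).charpoly = A.charpoly.map Complex.ofRealHom :=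
    Matrix.charpoly_map A Complex.ofRealHom
  set P := (A.map Complex.ofReal).charpoly with hP
  have hmonic : P.Monic := Matrix.charpoly_monic _
  have heig : ∀ z ∈ P.roots, ∃ l : ℝ, 0 < l ∧ (l : ℂ) = z := by
    intro z hz
    have hroot := (Polynomial.mem_roots hmonic.ne_zero).1 hz
    rw [hP, ← Matrix.charpoly_toLin', ← Module.End.hasEigenvalue_iff_isRoot_charpoly] at hroot
    obtain ⟨v, hv⟩ := hroot.exists_hasEigenvector
    have hv' : (A.map Complex.ofReal).mulVec v = z • v := by
      simpa using hv.apply_eq_smul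
    have him := hA.complex_eigenvalue_im_eq_zero hv.2 hv'
    have hz' : ((z.re : ℝ) : ℂ) = z := Complex.ext rfl (by simp [him])
    refine ⟨z.re, ?_, hz'⟩
    rw [← hz', hmap, Polynomial.mem_roots (hmap ▸ hmonic.ne_zero)] at hz
    have hreal : A.charpoly.IsRoot z.re :=
      Polynomial.IsRoot.of_map (f := Complex.ofRealHom) hz Complex.ofRealHom.injective
    rw [← Matrix.charpoly_toLin', ← Module.End.hasEigenvalue_iff_isRoot_charpoly] at hreal
    obtain ⟨u, hu⟩ := hreal.exists_hasEigenvector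
    exact hA.eigenvalue_pos hu.2 (by simpa using hu.apply_eq_smul)
  have hnodup : P.roots.Nodup := by
    rw [Multiset.nodup_iff_count_le_one]
    intro z
    by_cases hz : z ∈ P.roots
    · obtain ⟨l, -, rfl⟩ := heig z hz
      rw [Polynomial.count_roots, hmap]
      have := Polynomial.eq_rootMultiplicity_map (p := A.charpoly) Complex.ofRealHom.injective l
      exact this.symm.trans_le (hA.rootMultiplicity_charpoly_le_one l)
    · simp [Multiset.count_eq_zero_of_notMem hz]
  have hsplit : P.Splits := IsAlgClosed.splits P
  have hcard : Multiset.card P.roots = m + 1 := by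
    rw [← hsplit.natDegree_eq_card_roots, hP, Matrix.charpoly_natDegree_eq_dim, Fintype.card_fin]
  have hinj : Set.InjOn Complex.re (P.roots.toFinset : Set ℂ) := by
    intro z hz w hw hzw
    obtain ⟨l, -, rfl⟩ := heig z (by simpa using hz)
    obtain ⟨l', -, rfl⟩ := heig w (by simpa using hw)
    simpa using hzw
  let S : Finset ℝ := P.roots.toFinset.image Complex.re
  have hS : S.card = m + 1 := by
    rw [Finset.card_image_of_injOn hinj, Multiset.toFinset_card_of_nodup hnodup, hcard]
  refine ⟨S.orderEmbOfFin hS, (S.orderEmbOfFin hS).strictMono, fun i => ?_, ?_⟩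
  · obtain ⟨z, hz, hzi⟩ := Finset.mem_image.1 (S.orderEmbOfFin_mem hS i)
    obtain ⟨l, hl, rfl⟩ := heig z (by simpa using hz)
    rw [← hzi]
    simpa using hl
  · have h1 : ∏ i, (Polynomial.X - Polynomial.C ((S.orderEmbOfFin hS i : ℝ) : ℂ)) =
        ∏ x ∈ S, (Polynomial.X - Polynomial.C (x : ℂ)) := by
      conv_rhs => rw [← S.image_orderEmbOfFin_univ hS]
      rw [Finset.prod_image (S.orderEmbOfFin hS).injective.injOn]
    rw [h1, Finset.prod_image hinj]
    conv_lhs => rw [hsplit.eq_prod_roots_of_monic hmonic]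
    rw [Finset.prod_multiset_map_count]
    refine Finset.prod_congr rfl fun z hz => ?_
    rw [Multiset.mem_toFinset] at hz
    obtain ⟨l, -, rfl⟩ := heig z hz
    rw [Multiset.count_eq_one_of_mem hnodup hz, pow_one, Complex.ofReal_re]
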